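/- Let k ∈ ℕ, p ∈ [1,∞), and fix q_1,…,q_k ∈ [1,∞) with q_i ≠ p for all i, and positive constants t_1,…,t_k. Define I_> = {i : A_{p,q_i} t_i > 1}, I_= = {i : A_{p,q_i} t_i = 1}, I_< = {i : A_{p,q_i} t_i < 1}. Then lim_{n→∞} |𝔻_p^n ∩ t_1 𝔻_{q_1}^n ∩ ⋯ ∩ t_k 𝔻_{q_k}^n| equals 1 if #I_> = k; equals ℙ(N_i ≤ 0 for all i ∈ I_=) if #I_= ≥ 1 and #I_< = 0; and equals 0 if #I_< ≥ 1, where N = (N_1,…,N_k) is a centred Gaussian vector with covariance matrix (c_{i,j}), c_{i,j} = (1/(q_i q_j)) (Γ(1/p) Γ((q_i+q_j+1)/p)/(Γ((q_i+1)/p) Γ((q_j+1)/p)) − 1) − 1/p. -/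

import Mathlib

open MeasureTheory Set Filter
open scoped ENNReal Topology Pointwise

/-- The `q`-norm on `ℝ^n`. -/
noncomputable def pnorm {n : ℕ} (q : ℝ) (x : Fin n → ℝ) : ℝ :=
  (∑ i, |x i| ^ q) ^ (1 / q)

/-- The unit ball `𝔹_p^n`. -/
def pBall (n : ℕ) (p : ℝ) : Set (Fin n → ℝ) := {x | pnorm p x ≤ 1}

/-- The volume-normalized ball `𝔻_p^n = |𝔹_p^n|^{-1/n} 𝔹_p^n`. -/
noncomputable def nBall (n : ℕ) (p : ℝ) : Set (Fin n → ℝ) :=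
  ((volume (pBall n p)).toReal ^ (-(1 / (n : ℝ)))) • pBall n p

/-- `M_p(q)`. -/
noncomputable def Mp (p q : ℝ) : ℝ :=
  p ^ (q / p) / (q + 1) * (Real.Gamma (1 + (q + 1) / p) / Real.Gamma (1 + 1 / p))

/-- `m_{p,q} = M_p(q)^{1/q}`. -/
noncomputable def mpq (p q : ℝ) : ℝ := Mp p q ^ (1 / q)

/-- `k_{p,n} = n^{1/p} |𝔹_p^n|^{1/n}`. -/
noncomputable def kpn (p : ℝ) (n : ℕ) : ℝ :=
  (n : ℝ) ^ (1 / p) * (volume (pBall n p)).toReal ^ (1 / (n : ℝ))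

/-- `A_{p,q,n} = k_{p,n}/(m_{p,q} k_{q,n})`. -/
noncomputable def Apqn (p q : ℝ) (n : ℕ) : ℝ := kpn p n / (mpq p q * kpn q n)

/-- The covariance entries `c_{i,j}`. -/
noncomputable def covEntry (p qi qj : ℝ) : ℝ :=
  1 / (qi * qj) *
      (Real.Gamma (1 / p) * Real.Gamma ((qi + qj + 1) / p) /
          (Real.Gamma ((qi + 1) / p) * Real.Gamma ((qj + 1) / p)) - 1) -
    1 / p

/-- The density of the `p`-generalized Gaussian distribution. -/
noncomputable def genGaussPDF (p x : ℝ) : ℝ :=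
  (2 * p ^ (1 / p) * Real.Gamma (1 + 1 / p))⁻¹ * Real.exp (-(1 / p) * |x| ^ p)

/-- The `p`-generalized Gaussian distribution on `ℝ`. -/
noncomputable def genGauss (p : ℝ) : Measure ℝ :=
  volume.withDensity fun x => ENNReal.ofReal (genGaussPDF p x)

lemma genGaussPDF_pos {p : ℝ} (hp : 0 < p) (x : ℝ) : 0 < genGaussPDF p x := by
  have h : 0 < Real.Gamma (1 + 1 / p) := Real.Gamma_pos_of_pos (by positivity)
  unfold genGaussPDF
  positivity

@[fun_prop]
lemma measurable_genGaussPDF (p : ℝ) : Measurable (genGaussPDF p) := by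
  unfold genGaussPDF
  fun_prop

lemma Mp_eq {p s : ℝ} (hp : 0 < p) (hs : 0 ≤ s) :
    Mp p s = p ^ (s / p) * Real.Gamma ((s + 1) / p) / Real.Gamma (1 / p) := by
  have h1 : 0 < Real.Gamma (1 / p) := Real.Gamma_pos_of_pos (by positivity)
  rw [Mp, add_comm 1, add_comm 1, Real.Gamma_add_one (by positivity),
    Real.Gamma_add_one (by positivity)]
  field_simp

lemma Mp_pos {p s : ℝ} (hp : 0 < p) (hs : 0 ≤ s) : 0 < Mp p s := by
  have h1 : 0 < Real.Gamma (1 / p) := Real.Gamma_pos_of_pos (by positivity)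
  have h2 : 0 < Real.Gamma ((s + 1) / p) := Real.Gamma_pos_of_pos (by positivity)
  rw [Mp_eq hp hs]
  positivity

lemma Mp_add_self {p s : ℝ} (hp : 0 < p) (hs : 0 ≤ s) : Mp p (s + p) = (s + 1) * Mp p s := by
  rw [Mp_eq hp hs, Mp_eq hp (by positivity),
    show (s + p + 1) / p = (s + 1) / p + 1 by field_simp; ring,
    Real.Gamma_add_one (by positivity), show (s + p) / p = s / p + 1 by field_simp,
    Real.rpow_add_one hp.ne']
  field_simp

lemma Mp_zero {p : ℝ} (hp : 0 < p) : Mp p 0 = 1 := by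
  have h1 : 0 < Real.Gamma (1 / p) := Real.Gamma_pos_of_pos (by positivity)
  rw [Mp_eq hp le_rfl]
  simp at *
  exact h1.ne'

lemma Mp_self {p : ℝ} (hp : 0 < p) : Mp p p = 1 := by
  simpa [Mp_zero hp] using Mp_add_self hp le_rfl

lemma integral_genGaussPDF_mul_rpow {p s : ℝ} (hp : 0 < p) (hs : 0 ≤ s) :
    ∫ x, genGaussPDF p x * |x| ^ s = Mp p s := by
  have h1 : 0 < Real.Gamma (1 / p) := Real.Gamma_pos_of_pos (by positivity)
  have h := integral_comp_abs (f := fun x => (2 * p ^ (1 / p) * Real.Gamma (1 + 1 / p))⁻¹ *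
    Real.exp (-(1 / p) * x ^ p) * x ^ s)
  simp only [genGaussPDF]
  rw [h]
  simp_rw [mul_assoc, mul_comm (Real.exp _)]
  rw [integral_const_mul, integral_rpow_mul_exp_neg_mul_rpow hp (by linarith) (by positivity),
    Mp_eq hp hs, add_comm 1, Real.Gamma_add_one (by positivity), one_div p, Real.inv_rpow hp.le,
    ← Real.rpow_neg hp.le, show -(-(s + 1) / p) = s / p + p⁻¹ by field_simp,
    Real.rpow_add hp]
  rw [one_div] at h1
  field_simp

lemma integrable_genGaussPDF_mul_rpow {p s : ℝ} (hp : 0 < p) (hs : 0 ≤ s) :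
    Integrable fun x => genGaussPDF p x * |x| ^ s := by
  by_contra h
  have := integral_genGaussPDF_mul_rpow hp hs
  rw [integral_undef h] at this
  exact (Mp_pos hp hs).ne this

lemma isProbabilityMeasure_genGauss {p : ℝ} (hp : 0 < p) : IsProbabilityMeasure (genGauss p) := by
  constructor
  rw [genGauss, withDensity_apply _ MeasurableSet.univ, Measure.restrict_univ,
    ← ofReal_integral_eq_lintegral_ofReal]
  · have := integral_genGaussPDF_mul_rpow hp le_rfl
    simp only [Real.rpow_zero, mul_one, Mp_zero hp] at this
    simp [this]
  · simpa using integrable_genGaussPDF_mul_rpow hp le_rfl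
  · exact ae_of_all _ fun x => (genGaussPDF_pos hp x).le

lemma integral_genGauss {p : ℝ} (hp : 0 < p) (f : ℝ → ℝ) :
    ∫ x, f x ∂(genGauss p) = ∫ x, genGaussPDF p x * f x := by
  rw [genGauss, integral_withDensity_eq_integral_toReal_smul (by fun_prop)
    (ae_of_all _ fun x => ENNReal.ofReal_lt_top)]
  simp [ENNReal.toReal_ofReal (genGaussPDF_pos hp _).le]

lemma integral_rpow_genGauss {p s : ℝ} (hp : 0 < p) (hs : 0 ≤ s) :
    ∫ x, |x| ^ s ∂(genGauss p) = Mp p s := by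
  rw [integral_genGauss hp, integral_genGaussPDF_mul_rpow hp hs]

lemma integrable_rpow_genGauss {p s : ℝ} (hp : 0 < p) (hs : 0 ≤ s) :
    Integrable (fun x => |x| ^ s) (genGauss p) := by
  by_contra h
  have := integral_rpow_genGauss hp hs
  rw [integral_undef h] at this
  exact (Mp_pos hp hs).ne this

lemma volume_absolutelyContinuous_genGauss {p : ℝ} (hp : 0 < p) : volume ≪ genGauss p :=
  withDensity_absolutelyContinuous' (by fun_prop)
    (ae_of_all _ fun x => by simpa using genGaussPDF_pos hp x)

/-- The linearization at the mean of `log ‖x‖_s`, up to normalization, coordinatewise. -/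
noncomputable def normSummand (p s x : ℝ) : ℝ := (|x| ^ s / Mp p s - 1) / s

/-- The linearization of the logarithm of `‖x‖_s / ‖x‖_p`, coordinatewise. -/
noncomputable def ratioSummand (p s x : ℝ) : ℝ := normSummand p s x - normSummand p p x

lemma normSummand_mul {p s r : ℝ} (hs : 0 ≤ s) (hr : 0 ≤ r) :
    (fun x => normSummand p s x * normSummand p r x) = fun x =>
      (s * r)⁻¹ * ((Mp p s * Mp p r)⁻¹ * |x| ^ (s + r) - (Mp p s)⁻¹ * |x| ^ s
        - (Mp p r)⁻¹ * |x| ^ r + 1) := by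
  ext x
  simp only [normSummand, Real.rpow_add_of_nonneg (abs_nonneg x) hs hr]
  ring

lemma integrable_normSummand_mul {p s r : ℝ} (hp : 0 < p) (hs : 0 < s) (hr : 0 < r) :
    Integrable (fun x => normSummand p s x * normSummand p r x) (genGauss p) := by
  have := isProbabilityMeasure_genGauss hp
  rw [normSummand_mul hs.le hr.le]
  exact (((((integrable_rpow_genGauss hp (add_pos hs hr).le).const_mul _).sub
    ((integrable_rpow_genGauss hp hs.le).const_mul _)).sub
    ((integrable_rpow_genGauss hp hr.le).const_mul _)).add (integrable_const _)).const_mul _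

lemma integral_normSummand_mul {p s r : ℝ} (hp : 0 < p) (hs : 0 < s) (hr : 0 < r) :
    ∫ x, normSummand p s x * normSummand p r x ∂(genGauss p) =
      (s * r)⁻¹ * (Mp p (s + r) / (Mp p s * Mp p r) - 1) := by
  have := isProbabilityMeasure_genGauss hp
  have h1 := (integrable_rpow_genGauss hp (add_pos hs hr).le).const_mul (Mp p s * Mp p r)⁻¹
  have h2 := (integrable_rpow_genGauss hp hs.le).const_mul (Mp p s)⁻¹
  have h3 := (integrable_rpow_genGauss hp hr.le).const_mul (Mp p r)⁻¹
  have h4 : Integrable (fun x => (Mp p s * Mp p r)⁻¹ * |x| ^ (s + r) - (Mp p s)⁻¹ * |x| ^ s)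
    (genGauss p) := h1.sub h2
  rw [normSummand_mul hs.le hr.le, integral_const_mul, integral_add (by exact h4.sub h3)
    (integrable_const _), integral_sub h4 h3, integral_sub h1 h2, integral_const_mul,
    integral_const_mul, integral_const_mul, integral_rpow_genGauss hp (add_pos hs hr).le,
    integral_rpow_genGauss hp hs.le, integral_rpow_genGauss hp hr.le,
    inv_mul_cancel₀ (Mp_pos hp hs.le).ne', inv_mul_cancel₀ (Mp_pos hp hr.le).ne']
  simp
  left
  ring

lemma integral_normSummand {p s : ℝ} (hp : 0 < p) (hs : 0 < s) :
    ∫ x, normSummand p s x ∂(genGauss p) = 0 := by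
  have := isProbabilityMeasure_genGauss hp
  simp only [normSummand]
  rw [integral_div, integral_sub ((integrable_rpow_genGauss hp hs.le).div_const _)
    (integrable_const _), integral_div, integral_rpow_genGauss hp hs.le,
    div_self (Mp_pos hp hs.le).ne']
  simp

@[fun_prop]
lemma measurable_normSummand (p s : ℝ) : Measurable (normSummand p s) := by
  unfold normSummand; fun_prop

@[fun_prop]
lemma measurable_ratioSummand (p s : ℝ) : Measurable (ratioSummand p s) := by
  unfold ratioSummand; fun_prop

lemma memLp_normSummand {p s : ℝ} (hp : 0 < p) (hs : 0 < s) :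
    MemLp (normSummand p s) 2 (genGauss p) := by
  rw [memLp_two_iff_integrable_sq (by fun_prop)]
  simpa [sq] using integrable_normSummand_mul hp hs hs

lemma memLp_ratioSummand {p s : ℝ} (hp : 0 < p) (hs : 0 < s) :
    MemLp (ratioSummand p s) 2 (genGauss p) :=
  (memLp_normSummand hp hs).sub (memLp_normSummand hp hp)

lemma integral_ratioSummand {p s : ℝ} (hp : 0 < p) (hs : 0 < s) :
    ∫ x, ratioSummand p s x ∂(genGauss p) = 0 := by
  have := isProbabilityMeasure_genGauss hp
  simp only [ratioSummand]
  rw [integral_sub ((memLp_normSummand hp hs).integrable (by norm_num))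
    ((memLp_normSummand hp hp).integrable (by norm_num)), integral_normSummand hp hs,
    integral_normSummand hp hp, sub_zero]

lemma integral_ratioSummand_mul {p s r : ℝ} (hp : 0 < p) (hs : 0 < s) (hr : 0 < r) :
    ∫ x, ratioSummand p s x * ratioSummand p r x ∂(genGauss p) = covEntry p s r := by
  have : (fun x => ratioSummand p s x * ratioSummand p r x) = fun x =>
      normSummand p s x * normSummand p r x - normSummand p s x * normSummand p p x
      - normSummand p p x * normSummand p r x + normSummand p p x * normSummand p p x := by
    ext x; simp only [ratioSummand]; ring
  have h1 := integrable_normSummand_mul hp hs hr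
  have h2 := integrable_normSummand_mul hp hs hp
  have h3 := integrable_normSummand_mul hp hp hr
  have h4 := integrable_normSummand_mul hp hp hp
  have h5 : Integrable (fun x => normSummand p s x * normSummand p r x
    - normSummand p s x * normSummand p p x) (genGauss p) := h1.sub h2
  rw [this, integral_add (by exact h5.sub h3) h4, integral_sub h5 h3, integral_sub h1 h2,
    integral_normSummand_mul hp hs hr, integral_normSummand_mul hp hs hp,
    integral_normSummand_mul hp hp hr, integral_normSummand_mul hp hp hp, add_comm p r,
    Mp_add_self hp hs.le, Mp_add_self hp hr.le, Mp_add_self hp hp.le, Mp_self hp]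
  have e1 := Mp_pos hp hs.le
  have e2 := Mp_pos hp hr.le
  have e3 : Mp p (s + r) / (Mp p s * Mp p r) = Real.Gamma (1 / p) * Real.Gamma ((s + r + 1) / p) /
      (Real.Gamma ((s + 1) / p) * Real.Gamma ((r + 1) / p)) := by
    have g1 : 0 < Real.Gamma (1 / p) := Real.Gamma_pos_of_pos (by positivity)
    have g2 : 0 < Real.Gamma ((s + 1) / p) := Real.Gamma_pos_of_pos (by positivity)
    have g3 : 0 < Real.Gamma ((r + 1) / p) := Real.Gamma_pos_of_pos (by positivity)
    rw [Mp_eq hp hs.le, Mp_eq hp hr.le, Mp_eq hp (by positivity), add_div, Real.rpow_add hp]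
    field_simp
  rw [e3, covEntry, mul_one, one_mul, mul_div_cancel_right₀ _ e1.ne',
    mul_div_cancel_right₀ _ e2.ne']
  field_simp
  ring

lemma integrable_ratioSummand_mul {p s r : ℝ} (hp : 0 < p) (hs : 0 < s) (hr : 0 < r) :
    Integrable (fun x => ratioSummand p s x * ratioSummand p r x) (genGauss p) :=
  (memLp_ratioSummand hp hs).integrable_mul (memLp_ratioSummand hp hr)

lemma covEntry_self_pos {p s : ℝ} (hp : 0 < p) (hs : 0 < s) (h : s ≠ p) : 0 < covEntry p s s := by
  rw [← integral_ratioSummand_mul hp hs hs]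
  refine lt_of_le_of_ne (integral_nonneg fun x => mul_self_nonneg _) fun h0 => h ?_
  have h1 := (integral_eq_zero_iff_of_nonneg (fun x => mul_self_nonneg _)
    (integrable_ratioSummand_mul hp hs hs)).1 h0.symm
  have h2 : ratioSummand p s =ᵐ[volume] fun _ => 0 := by
    filter_upwards [(volume_absolutelyContinuous_genGauss hp).ae_le h1] with x hx
    simpa using hx
  have h3 : Continuous (ratioSummand p s) := by
    unfold ratioSummand normSummand
    have a1 : Continuous fun x : ℝ => |x| ^ s := continuous_abs.rpow_const fun _ => Or.inr hs.le
    have a2 : Continuous fun x : ℝ => |x| ^ p := continuous_abs.rpow_const fun _ => Or.inr hp.le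
    fun_prop
  have h4 := congrFun ((h3.ae_eq_iff_eq volume continuous_const).1 h2) 0
  simp [ratioSummand, normSummand, Real.zero_rpow hs.ne', Real.zero_rpow hp.ne'] at h4
  field_simp at h4
  linarith

lemma sum_abs_rpow_smul {n : ℕ} (q : ℝ) (r : ℝ) (x : Fin n → ℝ) :
    ∑ i, |(r • x) i| ^ q = |r| ^ q * ∑ i, |x i| ^ q := by
  simp [abs_mul, Real.mul_rpow, Finset.mul_sum]

lemma pnorm_smul {n : ℕ} {q : ℝ} (hq : 0 < q) (r : ℝ) (x : Fin n → ℝ) :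
    pnorm q (r • x) = |r| * pnorm q x := by
  have h : 0 ≤ ∑ i, |x i| ^ q := Finset.sum_nonneg fun _ _ => Real.rpow_nonneg (abs_nonneg _) _
  rw [pnorm, pnorm, sum_abs_rpow_smul, Real.mul_rpow (by positivity) h,
    ← Real.rpow_mul (abs_nonneg _),
    mul_one_div_cancel hq.ne', Real.rpow_one]

@[fun_prop]
lemma measurable_pnorm {n : ℕ} (q : ℝ) : Measurable (pnorm q : (Fin n → ℝ) → ℝ) := by
  unfold pnorm; fun_prop

lemma mem_pBall_iff {n : ℕ} {p : ℝ} (hp : 0 < p) (x : Fin n → ℝ) :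
    x ∈ pBall n p ↔ ∑ i, |x i| ^ p ≤ 1 := by
  have h : 0 ≤ ∑ i, |x i| ^ p := Finset.sum_nonneg fun _ _ => Real.rpow_nonneg (abs_nonneg _) _
  have := Real.rpow_le_rpow_iff h zero_le_one (one_div_pos.2 hp)
  rwa [Real.one_rpow] at this

lemma mem_smul_pBall_iff {n : ℕ} {p r : ℝ} (hp : 0 < p) (hr : 0 < r) (x : Fin n → ℝ) :
    x ∈ r • pBall n p ↔ pnorm p x ≤ r := by
  rw [mem_smul_set_iff_inv_smul_mem₀ hr.ne', pBall, mem_ofPred_eq, pnorm_smul hp,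
    abs_of_pos (inv_pos.2 hr), inv_mul_le_iff₀ hr, mul_one]

lemma volume_pBall {n : ℕ} (hn : n ≠ 0) {p : ℝ} (hp : 1 ≤ p) :
    volume (pBall n p) =
      ENNReal.ofReal ((2 * Real.Gamma (1 / p + 1)) ^ n / Real.Gamma (n / p + 1)) := by
  have : Nonempty (Fin n) := Fin.pos_iff_nonempty.1 (Nat.pos_of_ne_zero hn)
  simpa [pBall, pnorm] using volume_sum_rpow_le (Fin n) hp 1

lemma toReal_volume_pBall {n : ℕ} (hn : n ≠ 0) {p : ℝ} (hp : 1 ≤ p) :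
    (volume (pBall n p)).toReal =
      (2 * Real.Gamma (1 / p + 1)) ^ n / Real.Gamma (n / p + 1) := by
  rw [volume_pBall hn hp, ENNReal.toReal_ofReal]
  have h1 : 0 < Real.Gamma (1 / p + 1) := Real.Gamma_pos_of_pos (by positivity)
  have h2 : 0 < Real.Gamma (n / p + 1) := Real.Gamma_pos_of_pos (by positivity)
  positivity

lemma toReal_volume_pBall_pos {n : ℕ} (hn : n ≠ 0) {p : ℝ} (hp : 1 ≤ p) :
    0 < (volume (pBall n p)).toReal := by
  rw [toReal_volume_pBall hn hp]
  have h1 : 0 < Real.Gamma (1 / p + 1) := Real.Gamma_pos_of_pos (by positivity)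
  have h2 : 0 < Real.Gamma (n / p + 1) := Real.Gamma_pos_of_pos (by positivity)
  positivity

lemma volume_pBall_ne_top {n : ℕ} (hn : n ≠ 0) {p : ℝ} (hp : 1 ≤ p) :
    volume (pBall n p) ≠ ∞ := by
  rw [volume_pBall hn hp]; exact ENNReal.ofReal_ne_top

lemma pi_genGauss_eq_withDensity (n : ℕ) {p : ℝ} (hp : 0 < p) :
    Measure.pi (fun _ : Fin n => genGauss p) =
      volume.withDensity fun x => ENNReal.ofReal (∏ i, genGaussPDF p (x i)) := by
  have := isProbabilityMeasure_genGauss hp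
  have hint : Integrable (genGaussPDF p) := by
    simpa using integrable_genGaussPDF_mul_rpow hp le_rfl
  refine Measure.pi_eq fun s hs => ?_
  rw [withDensity_apply _ (MeasurableSet.univ_pi hs), volume_pi, Measure.restrict_pi_pi,
    ← ofReal_integral_eq_lintegral_ofReal,
    integral_fintype_prod_eq_prod (f := fun _ => genGaussPDF p),
    ENNReal.ofReal_prod_of_nonneg]
  · refine Finset.prod_congr rfl fun i _ => ?_
    rw [genGauss, withDensity_apply _ (hs i), ofReal_integral_eq_lintegral_ofReal hint.integrableOn]
    exact ae_of_all _ fun x => (genGaussPDF_pos hp x).le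
  · exact fun i _ => integral_nonneg fun x => (genGaussPDF_pos hp x).le
  · exact Integrable.fintype_prod (f := fun _ => genGaussPDF p) fun i => hint.integrableOn
  · exact ae_of_all _ fun x => Finset.prod_nonneg fun i _ => (genGaussPDF_pos hp (x i)).le

lemma lintegral_Ici_exp_neg (a : ℝ) :
    ∫⁻ t in Ici a, ENNReal.ofReal (Real.exp (-t)) = ENNReal.ofReal (Real.exp (-a)) := by
  rw [setLIntegral_congr Ioi_ae_eq_Ici.symm, ← ofReal_integral_eq_lintegral_ofReal
    (integrableOn_exp_neg_Ioi a) (ae_of_all _ fun x => (Real.exp_pos _).le), integral_exp_neg_Ioi]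

/-- The measure of a measurable cone under the product of generalized Gaussian measures is
proportional to the volume of its part in the unit ball. -/
lemma exists_pi_genGauss_eq_mul_volume (n : ℕ) {p : ℝ} (hp : 0 < p) :
    ∃ C : ℝ≥0∞, ∀ K : Set (Fin n → ℝ), MeasurableSet K →
      (∀ r : ℝ, 0 < r → ∀ x ∈ K, r • x ∈ K) →
      Measure.pi (fun _ : Fin n => genGauss p) K = C * volume (K ∩ pBall n p) := by
  set c := (2 * p ^ (1 / p) * Real.Gamma (1 + 1 / p))⁻¹ with hc
  have hc0 : 0 ≤ c := by
    have : 0 < Real.Gamma (1 + 1 / p) := Real.Gamma_pos_of_pos (by positivity)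
    positivity
  set S : (Fin n → ℝ) → ℝ := fun x => ∑ i, |x i| ^ p with hS
  have hSm : Measurable S := by fun_prop
  have hS0 : ∀ x, 0 ≤ S x := fun x =>
    Finset.sum_nonneg fun _ _ => Real.rpow_nonneg (abs_nonneg _) _
  have hdens : ∀ x : Fin n → ℝ, ENNReal.ofReal (∏ i, genGaussPDF p (x i)) =
      ENNReal.ofReal (c ^ n) * ∫⁻ t, (Ici (S x / p)).indicator
        (fun t => ENNReal.ofReal (Real.exp (-t))) t := by
    intro x
    rw [lintegral_indicator measurableSet_Ici, lintegral_Ici_exp_neg,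
      ← ENNReal.ofReal_mul (by positivity)]
    simp only [genGaussPDF, Finset.prod_mul_distrib, Finset.prod_const, Finset.card_univ,
      Fintype.card_fin, ← Real.exp_sum, ← Finset.mul_sum, ← hc, hS]
    congr 3
    ring
  set h : ℝ → ℝ≥0∞ := fun t =>
    if 0 < t then ENNReal.ofReal (((p * t) ^ (1 / p)) ^ n) else 0 with hh
  have hhm : Measurable h := Measurable.ite measurableSet_Ioi (by fun_prop) measurable_const
  refine ⟨ENNReal.ofReal (c ^ n) * ∫⁻ t, ENNReal.ofReal (Real.exp (-t)) * h t,
    fun K hK hcone => ?_⟩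
  rw [pi_genGauss_eq_withDensity n hp, withDensity_apply _ hK]
  simp_rw [hdens]
  have hjm : Measurable (fun z : (Fin n → ℝ) × ℝ => (Ici (S z.1 / p)).indicator
      (fun t => ENNReal.ofReal (Real.exp (-t))) z.2) := by
    have : (fun z : (Fin n → ℝ) × ℝ => (Ici (S z.1 / p)).indicator
      (fun t => ENNReal.ofReal (Real.exp (-t))) z.2) =
      {z : (Fin n → ℝ) × ℝ | S z.1 / p ≤ z.2}.indicator
        (fun z => ENNReal.ofReal (Real.exp (-z.2))) := by
      ext z; simp [indicator]
    rw [this]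
    exact Measurable.indicator (by fun_prop) (measurableSet_le (by fun_prop) (by fun_prop))
  rw [lintegral_const_mul _ hjm.lintegral_prod_right', mul_assoc,
    lintegral_lintegral_swap hjm.aemeasurable, ← lintegral_mul_const _ (by fun_prop)]
  congr 1
  refine lintegral_congr_ae ?_
  filter_upwards [Measure.ae_ne volume (0 : ℝ)] with t ht
  have e1 : ∀ x, (Ici (S x / p)).indicator (fun t => ENNReal.ofReal (Real.exp (-t))) t =
      {x | S x ≤ p * t}.indicator (fun _ => ENNReal.ofReal (Real.exp (-t))) x := by
    intro x
    simp [indicator, div_le_iff₀' hp]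
  simp_rw [e1]
  have hm : MeasurableSet {x | S x ≤ p * t} := measurableSet_le hSm measurable_const
  rw [lintegral_indicator_const hm, Measure.restrict_apply hm, mul_assoc]
  congr 1
  rcases lt_or_gt_of_ne ht with h0 | h0
  · have : {x | S x ≤ p * t} = ∅ := by
      ext x
      simpa using (mul_neg_of_pos_of_neg hp h0).trans_le (hS0 x)
    simp [this, hh, h0.not_gt]
  · have hr : 0 < (p * t) ^ (1 / p) := by positivity
    have : {x | S x ≤ p * t} ∩ K = (p * t) ^ (1 / p) • (K ∩ pBall n p) := by
      ext x
      rw [mem_smul_set_iff_inv_smul_mem₀ hr.ne', mem_inter_iff, mem_inter_iff, mem_pBall_iff hp,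
        sum_abs_rpow_smul, abs_of_pos (inv_pos.2 hr), Real.inv_rpow hr.le, ← Real.rpow_mul
        (by positivity), one_div_mul_cancel hp.ne', Real.rpow_one, inv_mul_le_iff₀ (by positivity),
        mul_one, and_comm]
      refine and_congr_left fun _ => ⟨fun hx => hcone _ (inv_pos.2 hr) x hx, fun hx => ?_⟩
      simpa only [smul_inv_smul₀ hr.ne'] using hcone _ hr _ hx
    rw [this, Measure.addHaar_smul]
    simp only [hh, h0, if_true, Module.finrank_fin_fun, abs_of_pos (pow_pos hr n)]

lemma volume_inter_pBall_of_cone {n : ℕ} {p : ℝ} (hp : 0 < p) {K : Set (Fin n → ℝ)}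
    (hK : MeasurableSet K) (hcone : ∀ r : ℝ, 0 < r → ∀ x ∈ K, r • x ∈ K) :
    volume (K ∩ pBall n p) =
      Measure.pi (fun _ : Fin n => genGauss p) K * volume (pBall n p) := by
  have := isProbabilityMeasure_genGauss hp
  obtain ⟨C, hC⟩ := exists_pi_genGauss_eq_mul_volume n hp
  have h1 := hC univ MeasurableSet.univ (by simp)
  rw [measure_univ, univ_inter] at h1
  rw [hC K hK hcone, mul_right_comm, ← h1, one_mul]

/-- The cone on which each `q i`-norm is at most `a i` times the `p`-norm. -/
def normCone {k : ℕ} (n : ℕ) (p : ℝ) (q a : Fin k → ℝ) : Set (Fin n → ℝ) :=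
  {x | ∀ i, pnorm (q i) x ≤ a i * pnorm p x}

lemma measurableSet_normCone {k : ℕ} (n : ℕ) (p : ℝ) (q a : Fin k → ℝ) :
    MeasurableSet (normCone n p q a) := by
  rw [normCone, ← iInter_ofPred]
  exact MeasurableSet.iInter fun i => measurableSet_le (by fun_prop) (by fun_prop)

lemma smul_mem_normCone {k n : ℕ} {p : ℝ} (hp : 0 < p) {q : Fin k → ℝ} (hq : ∀ i, 0 < q i)
    {a : Fin k → ℝ} {r : ℝ} (hr : 0 < r) {x : Fin n → ℝ} (hx : x ∈ normCone n p q a) :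
    r • x ∈ normCone n p q a := by
  intro i
  rw [pnorm_smul hp, pnorm_smul (hq i), abs_of_pos hr, mul_left_comm]
  exact mul_le_mul_of_nonneg_left (hx i) hr.le

/-- The radius of `t • 𝔻_q^n` relative to the normalization that turns `𝔻_p^n` into `𝔹_p^n`. -/
noncomputable def relRadius (n : ℕ) (p q t : ℝ) : ℝ :=
  t * (volume (pBall n p)).toReal ^ (1 / (n : ℝ)) / (volume (pBall n q)).toReal ^ (1 / (n : ℝ))

lemma volume_inter_nBall {k n : ℕ} (hn : n ≠ 0) {p : ℝ} (hp : 1 ≤ p) {q : Fin k → ℝ}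
    (hq : ∀ i, 1 ≤ q i) {t : Fin k → ℝ} (ht : ∀ i, 0 < t i) :
    volume (nBall n p ∩ ⋂ i, t i • nBall n (q i)) = (volume (pBall n p))⁻¹ *
      volume (pBall n p ∩ {x | ∀ i, pnorm (q i) x ≤ relRadius n p (q i) (t i)}) := by
  have hp0 : 0 < p := by linarith
  have hb := toReal_volume_pBall_pos hn hp
  have hβ := Real.rpow_pos_of_pos hb (-(1 / (n : ℝ)))
  have : nBall n p ∩ ⋂ i, t i • nBall n (q i) = (volume (pBall n p)).toReal ^ (-(1 / (n : ℝ))) •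
      (pBall n p ∩ {x | ∀ i, pnorm (q i) x ≤ relRadius n p (q i) (t i)}) := by
    rw [smul_set_inter₀ hβ.ne']
    congr 1
    ext x
    rw [mem_smul_set_iff_inv_smul_mem₀ hβ.ne', mem_iInter, mem_ofPred_eq]
    refine forall_congr' fun i => ?_
    have hqi : 0 < q i := zero_lt_one.trans_le (hq i)
    have hbi := toReal_volume_pBall_pos hn (hq i)
    rw [nBall, smul_smul, mem_smul_pBall_iff hqi (mul_pos (ht i) (Real.rpow_pos_of_pos hbi _)),
      pnorm_smul hqi, abs_of_pos (inv_pos.2 hβ), relRadius, Real.rpow_neg hb.le,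
      Real.rpow_neg hbi.le, inv_inv]
    have h1 := Real.rpow_pos_of_pos hb (1 / (n : ℝ))
    rw [mul_comm (t i) (_ ^ _), mul_div_assoc, mul_le_mul_iff_right₀ h1,
      ← div_eq_mul_inv]
  rw [this, Measure.addHaar_smul]
  congr 1
  rw [Module.finrank_fin_fun, abs_of_pos (by positivity), ← Real.rpow_natCast,
    ← Real.rpow_mul hb.le,
    neg_mul, one_div_mul_cancel (by exact_mod_cast hn), Real.rpow_neg_one,
    ENNReal.ofReal_inv_of_pos hb, ENNReal.ofReal_toReal (volume_pBall_ne_top hn hp)]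

lemma relRadius_nonneg {n : ℕ} {p q t : ℝ} (ht : 0 < t) : 0 ≤ relRadius n p q t := by
  unfold relRadius; positivity

lemma pi_genGauss_normCone_le_volume {k n : ℕ} (hn : n ≠ 0) {p : ℝ} (hp : 1 ≤ p)
    {q : Fin k → ℝ} (hq : ∀ i, 1 ≤ q i) {t : Fin k → ℝ} (ht : ∀ i, 0 < t i) :
    Measure.pi (fun _ : Fin n => genGauss p)
        (normCone n p q fun i => relRadius n p (q i) (t i)) ≤
      volume (nBall n p ∩ ⋂ i, t i • nBall n (q i)) := by
  have hp0 : 0 < p := by linarith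
  have h0 : volume (pBall n p) ≠ 0 := fun h => by
    simpa [h] using toReal_volume_pBall_pos hn hp
  rw [volume_inter_nBall hn hp hq ht, ← ENNReal.div_eq_inv_mul,
    ENNReal.le_div_iff_mul_le (Or.inl h0) (Or.inl (volume_pBall_ne_top hn hp)),
    ← volume_inter_pBall_of_cone hp0 (measurableSet_normCone n p q _)
      (fun r hr x hx => smul_mem_normCone hp0 (fun i => zero_lt_one.trans_le (hq i)) hr hx)]
  refine measure_mono fun x hx => ⟨hx.2, fun i => (hx.1 i).trans ?_⟩
  exact mul_le_of_le_one_right (relRadius_nonneg (ht i)) hx.2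

lemma volume_le_pi_genGauss_normCone {k n : ℕ} (hn : n ≠ 0) {p : ℝ} (hp : 1 ≤ p)
    {q : Fin k → ℝ} (hq : ∀ i, 1 ≤ q i) {t : Fin k → ℝ} (ht : ∀ i, 0 < t i)
    {δ : ℝ} (hδ : 0 < δ) :
    volume (nBall n p ∩ ⋂ i, t i • nBall n (q i)) ≤
      Measure.pi (fun _ : Fin n => genGauss p)
        (normCone n p q fun i => relRadius n p (q i) (t i) / δ) + ENNReal.ofReal (δ ^ n) := by
  have hp0 : 0 < p := by linarith
  have h0 : volume (pBall n p) ≠ 0 := fun h => by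
    simpa [h] using toReal_volume_pBall_pos hn hp
  rw [volume_inter_nBall hn hp hq ht, ← ENNReal.div_eq_inv_mul,
    ENNReal.div_le_iff h0 (volume_pBall_ne_top hn hp), add_mul,
    ← volume_inter_pBall_of_cone hp0 (measurableSet_normCone n p q _)
      (fun r hr x hx => smul_mem_normCone hp0 (fun i => zero_lt_one.trans_le (hq i)) hr hx)]
  have h1 : volume (δ • pBall n p) = ENNReal.ofReal (δ ^ n) * volume (pBall n p) := by
    rw [Measure.addHaar_smul, Module.finrank_fin_fun, abs_of_pos (by positivity)]
  rw [← h1]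
  refine (measure_mono fun x hx => ?_).trans (measure_union_le _ _)
  rcases le_total (pnorm p x) δ with h | h
  · exact Or.inr ((mem_smul_pBall_iff hp0 hδ x).2 h)
  · refine Or.inl ⟨fun i => (hx.2 i).trans ?_, hx.1⟩
    rw [div_mul_eq_mul_div, mul_div_assoc]
    exact le_mul_of_one_le_right (relRadius_nonneg (ht i)) ((one_le_div hδ).2 h)

lemma log_factorial_le {m : ℕ} (hm : 1 ≤ m) :
    Real.log (m.factorial : ℝ) ≤ m * Real.log m - m + Real.log m + 1 := by
  induction m, hm using Nat.le_induction with
  | base => simp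
  | succ m hm ih =>
    have hm0 : (0 : ℝ) < m := by exact_mod_cast hm
    have h1 : Real.log (m / (m + 1)) ≤ m / (m + 1) - 1 := Real.log_le_sub_one_of_pos (by positivity)
    rw [Real.log_div hm0.ne' (by positivity)] at h1
    have h2 := mul_le_mul_of_nonneg_left h1 (show (0 : ℝ) ≤ m + 1 by positivity)
    rw [show (m + 1 : ℝ) * (m / (m + 1) - 1) = -1 by field_simp; ring] at h2
    rw [Nat.factorial_succ, Nat.cast_mul, Real.log_mul (by positivity) (by positivity)]
    push_cast
    linarith

lemma abs_log_Gamma_sub_le {x : ℝ} (hx : 1 ≤ x) :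
    |Real.log (Real.Gamma (x + 1)) - (x * Real.log x - x)| ≤ 2 * Real.log x + 2 := by
  set m := ⌊x⌋₊ with hm
  have hm1 : 1 ≤ m := Nat.one_le_floor_iff x |>.2 hx
  have hm1' : (1 : ℝ) ≤ m := by exact_mod_cast hm1
  have hmx : (m : ℝ) ≤ x := Nat.floor_le (by linarith)
  have hxm : x < m + 1 := Nat.lt_floor_add_one x
  have hmono := Real.Gamma_strictMonoOn_Ici.monotoneOn
  have hlx : 0 ≤ Real.log x := Real.log_nonneg hx
  have hlm : 0 ≤ Real.log m := Real.log_nonneg hm1'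
  rw [abs_le]
  constructor
  · have h1 : Real.Gamma (m + 1) ≤ Real.Gamma (x + 1) :=
      hmono (by simp only [mem_Ici]; linarith) (by simp only [mem_Ici]; linarith) (by linarith)
    rw [Real.Gamma_nat_eq_factorial] at h1
    have h2 := Real.log_le_log (by positivity) h1
    have h3 := Stirling.le_log_factorial_stirling (n := m) (by lia)
    have h4 : 0 ≤ Real.log (2 * Real.pi) := Real.log_nonneg (by linarith [Real.pi_gt_three])
    have h5 : Real.log (x / m) ≤ x / m - 1 := Real.log_le_sub_one_of_pos (by positivity)
    rw [Real.log_div (by positivity) (by positivity)] at h5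
    have h6 := mul_le_mul_of_nonneg_left h5 (show (0 : ℝ) ≤ m by positivity)
    rw [show (m : ℝ) * (x / m - 1) = x - m by field_simp] at h6
    have h7 : (x - m) * Real.log x ≤ 1 * Real.log x :=
      mul_le_mul_of_nonneg_right (by linarith) hlx
    linarith
  · have h1 : Real.Gamma (x + 1) ≤ Real.Gamma ((m + 1 : ℕ) + 1) := by
      push_cast
      exact hmono (by simp only [mem_Ici]; linarith) (by simp only [mem_Ici]; linarith)
        (by linarith)
    rw [Real.Gamma_nat_eq_factorial, Nat.factorial_succ] at h1
    have h2 := Real.log_le_log (Real.Gamma_pos_of_pos (by linarith)) h1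
    rw [Nat.cast_mul, Real.log_mul (by positivity) (by positivity)] at h2
    have h3 := log_factorial_le hm1
    have h4 : Real.log m ≤ Real.log x := Real.log_le_log (by linarith) hmx
    have h5 : Real.log ((m + 1 : ℕ) : ℝ) ≤ Real.log (2 * x) :=
      Real.log_le_log (by positivity) (by push_cast; linarith)
    rw [Real.log_mul (by norm_num) (by linarith)] at h5
    have h6 : Real.log 2 ≤ 1 := by linarith [Real.log_two_lt_d9]
    have h7 : Real.log (m / x) ≤ m / x - 1 := Real.log_le_sub_one_of_pos (by positivity)
    rw [Real.log_div (by positivity) (by positivity)] at h7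
    have h8 := mul_le_mul_of_nonneg_left h7 (show (0 : ℝ) ≤ x by positivity)
    rw [show x * (m / x - 1) = m - x by field_simp] at h8
    have h9 : 0 ≤ (x - m) * Real.log m := mul_nonneg (by linarith) hlm
    linarith

lemma kpn_pos {n : ℕ} (hn : n ≠ 0) {p : ℝ} (hp : 1 ≤ p) : 0 < kpn p n := by
  have := toReal_volume_pBall_pos hn hp
  unfold kpn
  positivity

lemma abs_log_kpn_sub_le {n : ℕ} {p : ℝ} (hp : 1 ≤ p) (hn : p ≤ n) :
    |Real.log (kpn p n) - (Real.log (2 * Real.Gamma (1 / p + 1)) + Real.log p / p + 1 / p)| ≤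
      (2 * Real.log n + 2) / n := by
  have hn1 : (1 : ℝ) ≤ n := hp.trans hn
  have hn0 : n ≠ 0 := by rintro rfl; norm_num at hn1
  have hg : 0 < Real.Gamma (1 / p + 1) := Real.Gamma_pos_of_pos (by positivity)
  have hg' : 0 < Real.Gamma (n / p + 1) := Real.Gamma_pos_of_pos (by positivity)
  have hv := toReal_volume_pBall_pos hn0 hp
  have h1 := abs_log_Gamma_sub_le ((one_le_div (by linarith)).2 hn)
  have h2 : Real.log (n / p) ≤ Real.log n :=
    Real.log_le_log (by positivity) (div_le_self (by positivity) hp)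
  have h3 : Real.log (n / p) = Real.log n - Real.log p :=
    Real.log_div (by positivity) (by positivity)
  have h4 : Real.log (kpn p n) - (Real.log (2 * Real.Gamma (1 / p + 1)) + Real.log p / p + 1 / p) =
      -(Real.log (Real.Gamma (n / p + 1)) - (n / p * Real.log (n / p) - n / p)) / n := by
    rw [kpn, Real.log_mul (by positivity) (by positivity), Real.log_rpow (by positivity),
      Real.log_rpow hv, toReal_volume_pBall hn0 hp, Real.log_div (by positivity) hg'.ne',
      Real.log_pow, h3]
    field_simp
    ring
  rw [h4, abs_div, abs_neg, abs_of_pos (show (0 : ℝ) < n by positivity)]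
  gcongr
  linarith

lemma tendsto_sqrt_mul_log_kpn_sub {p : ℝ} (hp : 1 ≤ p) :
    Tendsto (fun n : ℕ => √n * (Real.log (kpn p n) -
      (Real.log (2 * Real.Gamma (1 / p + 1)) + Real.log p / p + 1 / p))) atTop (𝓝 0) := by
  have h1 : Tendsto (fun x : ℝ => 2 * (Real.log x / x ^ (1 / 2 : ℝ)) + 2 * x ^ (-(1 / 2) : ℝ)) atTop
      (𝓝 (2 * 0 + 2 * 0)) :=
    ((isLittleO_log_rpow_atTop (by norm_num)).tendsto_div_nhds_zero.const_mul _).add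
      ((tendsto_rpow_neg_atTop (by norm_num)).const_mul _)
  have h2 := h1.comp tendsto_natCast_atTop_atTop
  rw [mul_zero, add_zero] at h2
  refine squeeze_zero_norm' ?_ h2
  filter_upwards [eventually_ge_atTop ⌈p⌉₊] with n hn
  have hn' : p ≤ n := (Nat.le_ceil p).trans (by exact_mod_cast hn)
  have hn0 : (0 : ℝ) < n := by linarith
  rw [norm_mul, Real.norm_of_nonneg (Real.sqrt_nonneg _)]
  refine (mul_le_mul_of_nonneg_left (abs_log_kpn_sub_le hp hn') (Real.sqrt_nonneg _)).trans_eq ?_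
  simp only [Function.comp]
  rw [Real.rpow_neg hn0.le, ← Real.sqrt_eq_rpow]
  have h3 := Real.sqrt_pos.2 hn0
  have h4 : (√(n : ℝ))⁻¹ * n = √n := by
    rw [inv_mul_eq_iff_eq_mul₀ h3.ne', Real.mul_self_sqrt hn0.le]
  rw [mul_div_assoc', div_eq_iff hn0.ne']
  linear_combination (-(2 * Real.log n + 2)) * h4

lemma mpq_pos {p q : ℝ} (hp : 0 < p) (hq : 0 ≤ q) : 0 < mpq p q :=
  Real.rpow_pos_of_pos (Mp_pos hp hq) _

lemma tendsto_sqrt_mul_log_Apqn_sub {p q A : ℝ} (hp : 1 ≤ p) (hq : 1 ≤ q) (hA : 0 < A)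
    (h : Tendsto (fun n : ℕ => Apqn p q n) atTop (𝓝 A)) :
    Tendsto (fun n : ℕ => √n * (Real.log (Apqn p q n) - Real.log A)) atTop (𝓝 0) := by
  have h1 := (tendsto_sqrt_mul_log_kpn_sub hp).sub (tendsto_sqrt_mul_log_kpn_sub hq)
  set c := Real.log (2 * Real.Gamma (1 / p + 1)) + Real.log p / p + 1 / p
  set d := Real.log (2 * Real.Gamma (1 / q + 1)) + Real.log q / q + 1 / q
  set e := c - Real.log (mpq p q) - d with he
  rw [sub_zero] at h1
  have h2 : Tendsto (fun n : ℕ => √n * (Real.log (Apqn p q n) - e)) atTop (𝓝 0) := by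
    refine h1.congr' ?_
    filter_upwards [eventually_ne_atTop 0] with n hn
    have hm := mpq_pos (p := p) (q := q) (by linarith) (by linarith)
    rw [Apqn, Real.log_div (kpn_pos hn hp).ne' (mul_pos hm (kpn_pos hn hq)).ne',
      Real.log_mul hm.ne' (kpn_pos hn hq).ne', he]
    ring
  have h3 : Tendsto (fun n : ℕ => Real.log (Apqn p q n) - e) atTop (𝓝 0) := by
    have h4 : Tendsto (fun n : ℕ => (√(n : ℝ))⁻¹) atTop (𝓝 0) :=
      tendsto_inv_atTop_zero.comp (Real.tendsto_sqrt_atTop.comp tendsto_natCast_atTop_atTop)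
    have h5 := h4.mul h2
    rw [mul_zero] at h5
    refine h5.congr' ?_
    filter_upwards [eventually_ne_atTop 0] with n hn
    have : √(n : ℝ) ≠ 0 := by positivity
    rw [inv_mul_cancel_left₀ this]
  have h6 : Tendsto (fun n : ℕ => Real.log (Apqn p q n) - e) atTop (𝓝 (Real.log A - e)) :=
    (h.log hA.ne').sub_const e
  rw [show Real.log A = e by linarith [tendsto_nhds_unique h3 h6]]
  exact h2

/-- The logarithm of the `s`-norm on `ℝ^n`, centred for the generalized Gaussian distribution. -/
noncomputable def logNorm {n : ℕ} (p s : ℝ) (x : Fin n → ℝ) : ℝ :=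
  Real.log ((∑ i, |x i| ^ s) / (n * Mp p s)) / s

lemma log_pnorm {n : ℕ} (hn : n ≠ 0) {p s : ℝ} (hp : 0 < p) (hs : 0 < s) {x : Fin n → ℝ}
    (hx : 0 < ∑ i, |x i| ^ s) :
    Real.log (pnorm s x) = logNorm p s x + Real.log n / s + Real.log (mpq p s) := by
  have hM := Mp_pos hp hs.le
  have hn' : (n : ℝ) ≠ 0 := by exact_mod_cast hn
  rw [pnorm, logNorm, mpq, Real.log_rpow hx, Real.log_rpow hM,
    Real.log_div hx.ne' (mul_ne_zero hn' hM.ne'), Real.log_mul hn' hM.ne']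
  ring

lemma log_relRadius {n : ℕ} (hn : n ≠ 0) {p q t : ℝ} (hp : 1 ≤ p) (hq : 1 ≤ q) (ht : 0 < t) :
    Real.log (relRadius n p q t) = Real.log t + Real.log (Apqn p q n) + Real.log (mpq p q)
      + Real.log n / q - Real.log n / p := by
  have hn' : (0 : ℝ) < n := by positivity
  have hm := mpq_pos (p := p) (q := q) (by linarith) (by linarith)
  have h1 := toReal_volume_pBall_pos hn hp
  have h2 := toReal_volume_pBall_pos hn hq
  have h3 := Real.rpow_pos_of_pos h1 (1 / (n : ℝ))
  have h4 := Real.rpow_pos_of_pos h2 (1 / (n : ℝ))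
  rw [Apqn, Real.log_div (kpn_pos hn hp).ne' (mul_pos hm (kpn_pos hn hq)).ne',
    Real.log_mul hm.ne' (kpn_pos hn hq).ne', relRadius,
    Real.log_div (by positivity) (by positivity),
    Real.log_mul ht.ne' (by positivity), kpn, kpn, Real.log_mul (by positivity) (by positivity),
    Real.log_mul (by positivity) (by positivity), Real.log_rpow hn', Real.log_rpow hn']
  ring

lemma sum_abs_rpow_pos {n : ℕ} (s : ℝ) {x : Fin n → ℝ} (hx : x ≠ 0) :
    0 < ∑ i, |x i| ^ s := by
  obtain ⟨i, hi⟩ := Function.ne_iff.1 hx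
  exact Finset.sum_pos' (fun _ _ => Real.rpow_nonneg (abs_nonneg _) _)
    ⟨i, Finset.mem_univ _, Real.rpow_pos_of_pos (abs_pos.2 hi) _⟩

lemma mem_normCone_iff {k n : ℕ} (hn : n ≠ 0) {p : ℝ} (hp : 1 ≤ p) {q : Fin k → ℝ}
    (hq : ∀ i, 1 ≤ q i) {t : Fin k → ℝ} (ht : ∀ i, 0 < t i) {δ : ℝ} (hδ : 0 < δ)
    {x : Fin n → ℝ} (hx : x ≠ 0) :
    (x ∈ normCone n p q fun i => relRadius n p (q i) (t i) / δ) ↔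
      ∀ i, logNorm p (q i) x - logNorm p p x ≤
        Real.log (Apqn p (q i) n) + Real.log (t i) - Real.log δ := by
  have hp0 : 0 < p := by linarith
  refine forall_congr' fun i => ?_
  have hq0 : 0 < q i := zero_lt_one.trans_le (hq i)
  have h1 := sum_abs_rpow_pos p hx
  have h2 := sum_abs_rpow_pos (q i) hx
  have h3 : 0 < pnorm p x := Real.rpow_pos_of_pos h1 _
  have h4 : 0 < pnorm (q i) x := Real.rpow_pos_of_pos h2 _
  have hr : 0 < relRadius n p (q i) (t i) := by
    have h1 := toReal_volume_pBall_pos hn hp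
    have h2 := toReal_volume_pBall_pos hn (hq i)
    have := ht i
    unfold relRadius
    positivity
  rw [← Real.log_le_log_iff h4 (by positivity), Real.log_mul (by positivity) h3.ne',
    Real.log_div hr.ne' hδ.ne', log_relRadius hn hp (hq i) (ht i), log_pnorm hn hp0 hq0 h2,
    log_pnorm hn hp0 hp0 h1]
  have : mpq p p = 1 := by rw [mpq, Mp_self hp0, Real.one_rpow]
  rw [this, Real.log_one]
  constructor <;> intro h <;> linarith

lemma tendstoInDistribution_of_forall_sum_mul {Ω : Type*} [MeasurableSpace Ω] {P : Measure Ω}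
    [IsProbabilityMeasure P] {k : ℕ} {X : ℕ → Ω → Fin k → ℝ} (hX : ∀ n, Measurable (X n))
    {N : Measure (Fin k → ℝ)} [IsProbabilityMeasure N]
    (h : ∀ u : Fin k → ℝ, TendstoInDistribution (fun n ω => ∑ i, u i * X n ω i) atTop
      (fun y => ∑ i, u i * y i) (fun _ => P) N) :
    TendstoInDistribution X atTop id (fun _ => P) N := by
  have key : TendstoInDistribution (fun n ω => WithLp.toLp 2 (X n ω)) atTop (WithLp.toLp 2)
      (fun _ => P) N := by
    refine ⟨fun n => by fun_prop, by fun_prop, ?_⟩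
    refine ProbabilityMeasure.tendsto_iff_tendsto_charFun.2 fun u => ?_
    have h1 := ProbabilityMeasure.tendsto_iff_tendsto_charFun.1 (h u.ofLp).tendsto 1
    simp only [charFun_apply, ProbabilityMeasure.coe_mk] at h1 ⊢
    have hm : Measurable fun y : Fin k → ℝ => ∑ i, u.ofLp i * y i := by fun_prop
    rw [integral_map hm.aemeasurable (by fun_prop)] at h1
    rw [integral_map (by fun_prop) (by fun_prop)]
    refine (h1.congr fun n => ?_).trans_eq ?_
    · rw [integral_map (by fun_prop) (by fun_prop), integral_map (by fun_prop) (by fun_prop)]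
      simp [PiLp.inner_apply]
    · simp [PiLp.inner_apply]
  exact key.continuous_comp (g := WithLp.ofLp) (by fun_prop)

/-- The law of a sequence of independent generalized Gaussian variables. -/
noncomputable def seqGenGauss (p : ℝ) : Measure (ℕ → ℝ) := Measure.infinitePi fun _ => genGauss p

lemma isProbabilityMeasure_seqGenGauss {p : ℝ} (hp : 0 < p) :
    IsProbabilityMeasure (seqGenGauss p) := by
  have := isProbabilityMeasure_genGauss hp
  unfold seqGenGauss
  infer_instance

lemma measurePreserving_eval_seqGenGauss {p : ℝ} (hp : 0 < p) (j : ℕ) :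
    MeasurePreserving (fun ω : ℕ → ℝ => ω j) (seqGenGauss p) (genGauss p) := by
  have := isProbabilityMeasure_genGauss hp
  exact measurePreserving_eval_infinitePi (fun _ => genGauss p) j

lemma iIndepFun_comp_seqGenGauss {p : ℝ} (hp : 0 < p) {f : ℝ → ℝ} (hf : Measurable f) :
    ProbabilityTheory.iIndepFun (fun (j : ℕ) (ω : ℕ → ℝ) => f (ω j)) (seqGenGauss p) := by
  have := isProbabilityMeasure_genGauss hp
  exact ProbabilityTheory.iIndepFun_infinitePi fun _ => hf

lemma map_seqGenGauss_fin {p : ℝ} (hp : 0 < p) (n : ℕ) :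
    (seqGenGauss p).map (fun ω (i : Fin n) => ω i) = Measure.pi fun _ : Fin n => genGauss p := by
  have := isProbabilityMeasure_seqGenGauss hp
  have h1 := (iIndepFun_comp_seqGenGauss hp measurable_id).precomp
    (Fin.val_injective (n := n))
  rw [ProbabilityTheory.iIndepFun_iff_map_fun_eq_pi_map 
    (fun i => Measurable.aemeasurable (by fun_prop))] at h1
  refine h1.trans ?_
  congr with i : 1
  exact (measurePreserving_eval_seqGenGauss hp _).map_eq

lemma identDistrib_comp_seqGenGauss {p : ℝ} (hp : 0 < p) {f : ℝ → ℝ} (hf : Measurable f) (j : ℕ) :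
    ProbabilityTheory.IdentDistrib (fun ω : ℕ → ℝ => f (ω j)) (fun ω : ℕ → ℝ => f (ω 0))
      (seqGenGauss p) (seqGenGauss p) := by
  refine ProbabilityTheory.IdentDistrib.comp (u := f)
    ⟨Measurable.aemeasurable (by fun_prop), Measurable.aemeasurable (by fun_prop), ?_⟩ hf
  rw [(measurePreserving_eval_seqGenGauss hp _).map_eq,
    (measurePreserving_eval_seqGenGauss hp _).map_eq]

lemma memLp_comp_seqGenGauss {p : ℝ} (hp : 0 < p) {f : ℝ → ℝ} (hf : MemLp f 2 (genGauss p))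
    (j : ℕ) : MemLp (fun ω : ℕ → ℝ => f (ω j)) 2 (seqGenGauss p) :=
  hf.comp_measurePreserving (measurePreserving_eval_seqGenGauss hp j)

lemma integral_comp_seqGenGauss {p : ℝ} (hp : 0 < p) {f : ℝ → ℝ} (hf : Measurable f) (j : ℕ) :
    ∫ ω, f (ω j) ∂(seqGenGauss p) = ∫ x, f x ∂(genGauss p) := by
  rw [← (measurePreserving_eval_seqGenGauss hp j).map_eq,
    integral_map (Measurable.aemeasurable (by fun_prop)) (by fun_prop)]

lemma variance_comp_seqGenGauss {p : ℝ} (hp : 0 < p) {f : ℝ → ℝ} (hf : Measurable f)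
    (h0 : ∫ x, f x ∂(genGauss p) = 0) (j : ℕ) :
    ProbabilityTheory.variance (fun ω : ℕ → ℝ => f (ω j)) (seqGenGauss p) =
      ∫ x, f x ^ 2 ∂(genGauss p) := by
  rw [ProbabilityTheory.variance_of_integral_eq_zero
    (Measurable.aemeasurable (by fun_prop))
    (by rw [integral_comp_seqGenGauss hp hf, h0]),
    ← integral_comp_seqGenGauss hp (by fun_prop) j]

/-- The normalized sums of the linearized logarithmic norm ratios. -/
noncomputable def ratioSum {k : ℕ} (p : ℝ) (q : Fin k → ℝ) (n : ℕ) (ω : ℕ → ℝ) : Fin k → ℝ :=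
  fun i => (√n)⁻¹ * ∑ j ∈ Finset.range n, ratioSummand p (q i) (ω j)

@[fun_prop]
lemma measurable_ratioSum {k : ℕ} (p : ℝ) (q : Fin k → ℝ) (n : ℕ) :
    Measurable (ratioSum p q n) := by
  unfold ratioSum; fun_prop

lemma tendstoInDistribution_ratioSum {k : ℕ} {p : ℝ} (hp : 0 < p) {q : Fin k → ℝ}
    (hq : ∀ i, 0 < q i) [IsProbabilityMeasure (seqGenGauss p)]
    {N : Measure (Fin k → ℝ)} [IsProbabilityMeasure N]
    (hN : ∀ u : Fin k → ℝ,
      Measure.map (fun y => ∑ i, u i * y i) N =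
        ProbabilityTheory.gaussianReal 0
          ((∑ i, ∑ j, u i * covEntry p (q i) (q j) * u j).toNNReal)) :
    TendstoInDistribution (ratioSum p q) atTop id (fun _ => seqGenGauss p) N := by
  refine tendstoInDistribution_of_forall_sum_mul (fun n => by fun_prop) fun u => ?_
  set f : ℝ → ℝ := fun x => ∑ i, u i * ratioSummand p (q i) x with hf
  have hfm : Measurable f := by fun_prop
  have hL : MemLp f 2 (genGauss p) :=
    memLp_finsetSum _ fun i _ => (memLp_ratioSummand hp (hq i)).const_mul (u i)
  have := isProbabilityMeasure_genGauss hp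
  have h0 : ∫ x, f x ∂(genGauss p) = 0 := by
    rw [integral_finsetSum _ fun i _ =>
      ((memLp_ratioSummand hp (hq i)).integrable (by norm_num)).const_mul (u i)]
    simp [integral_const_mul, integral_ratioSummand hp (hq _)]
  have h2 : ∫ x, f x ^ 2 ∂(genGauss p) = ∑ i, ∑ j, u i * covEntry p (q i) (q j) * u j := by
    have : (fun x => f x ^ 2) = fun x => ∑ i, ∑ j,
        u i * u j * (ratioSummand p (q i) x * ratioSummand p (q j) x) := by
      ext x
      rw [hf, sq, Finset.sum_mul_sum]
      refine Finset.sum_congr rfl fun i _ => Finset.sum_congr rfl fun j _ => by ring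
    have hi (i j) : Integrable (fun x => u i * u j *
        (ratioSummand p (q i) x * ratioSummand p (q j) x)) (genGauss p) :=
      (integrable_ratioSummand_mul hp (hq i) (hq j)).const_mul _
    rw [this, integral_finsetSum _ fun i _ => integrable_finsetSum _ fun j _ => hi i j]
    refine Finset.sum_congr rfl fun i _ => ?_
    rw [integral_finsetSum _ fun j _ => hi i j]
    refine Finset.sum_congr rfl fun j _ => ?_
    rw [integral_const_mul, integral_ratioSummand_mul hp (hq i) (hq j)]
    ring
  have h3 := ProbabilityTheory.tendstoInDistribution_inv_sqrt_mul_sum_sub (P := seqGenGauss p)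
    (P' := N) (Y := fun y => ∑ i, u i * y i)
    (X := fun (j : ℕ) ω => f (ω j))
    ⟨Measurable.aemeasurable (by fun_prop), by rw [variance_comp_seqGenGauss hp hfm h0, h2, hN u]⟩
    (memLp_comp_seqGenGauss hp hL 0) (iIndepFun_comp_seqGenGauss hp hfm)
    (identDistrib_comp_seqGenGauss hp hfm)
  convert h3 using 3 with n ω
  rw [integral_comp_seqGenGauss hp hfm, h0, mul_zero, sub_zero]
  simp only [hf, ratioSum]
  rw [Finset.sum_comm, Finset.mul_sum]
  refine Finset.sum_congr rfl fun i _ => ?_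
  rw [← Finset.mul_sum]
  ring

lemma seqGenGauss_abs_sum_ge_le {p : ℝ} (hp : 0 < p) {f : ℝ → ℝ} (hfm : Measurable f)
    (hf : MemLp f 2 (genGauss p)) (h0 : ∫ x, f x ∂(genGauss p) = 0) (n : ℕ) {c : ℝ} (hc : 0 < c) :
    seqGenGauss p {ω | c ≤ |∑ j ∈ Finset.range n, f (ω j)|} ≤
      ENNReal.ofReal (n * (∫ x, f x ^ 2 ∂(genGauss p)) / c ^ 2) := by
  have := isProbabilityMeasure_seqGenGauss hp
  have h1 := ProbabilityTheory.meas_ge_le_variance_div_sq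
    (memLp_finsetSum' (Finset.range n) fun j _ => memLp_comp_seqGenGauss hp hf j) hc
  have h2 : ∫ ω, (∑ j ∈ Finset.range n, fun ω : ℕ → ℝ => f (ω j)) ω ∂(seqGenGauss p) = 0 := by
    simp only [Finset.sum_apply]
    rw [integral_finsetSum _ fun j _ =>
      (memLp_comp_seqGenGauss hp hf j).integrable (by norm_num)]
    simp [integral_comp_seqGenGauss hp hfm, h0]
  have h3 := ProbabilityTheory.IndepFun.variance_sum (s := Finset.range n)
    (fun j _ => memLp_comp_seqGenGauss hp hf j)
    (fun i _ j _ hij => (iIndepFun_comp_seqGenGauss hp hfm).indepFun hij)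
  rw [h2, h3] at h1
  simp only [Finset.sum_apply, sub_zero, variance_comp_seqGenGauss hp hfm h0, Finset.sum_const,
    Finset.card_range, nsmul_eq_mul] at h1
  exact h1

lemma abs_log_one_add_sub_le {y : ℝ} (hy : |y| ≤ 1 / 2) : |Real.log (1 + y) - y| ≤ 2 * y ^ 2 := by
  obtain ⟨h1, h2⟩ := abs_le.1 hy
  have h3 : 0 < 1 + y := by linarith
  have h4 := Real.log_le_sub_one_of_pos h3
  have h5 := Real.one_sub_inv_le_log_of_pos h3
  have h6 : y - 2 * y ^ 2 ≤ 1 - (1 + y)⁻¹ := by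
    rw [show 1 - (1 + y)⁻¹ = y / (1 + y) by field_simp; ring, le_div_iff₀ h3]
    nlinarith [mul_nonneg (sq_nonneg y) (show 0 ≤ 1 + 2 * y by linarith)]
  rw [abs_le]
  constructor <;> linarith [sq_nonneg y]

lemma logNorm_eq {n : ℕ} (hn : n ≠ 0) {p s : ℝ} (hp : 0 < p) (hs : 0 < s) (ω : ℕ → ℝ) :
    logNorm p s (fun j : Fin n => ω j) =
      Real.log (1 + s * (∑ j ∈ Finset.range n, normSummand p s (ω j)) / n) / s := by
  have hM := Mp_pos hp hs.le
  have hn' : (n : ℝ) ≠ 0 := by exact_mod_cast hn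
  rw [logNorm, Fin.sum_univ_eq_sum_range fun j => |ω j| ^ s]
  simp only [normSummand]
  rw [← Finset.sum_div, Finset.sum_sub_distrib, ← Finset.sum_div]
  congr 2
  simp
  field_simp
  ring

lemma tendstoInMeasure_logNorm_sub {p s : ℝ} (hp : 0 < p) (hs : 0 < s) :
    TendstoInMeasure (seqGenGauss p) (fun (n : ℕ) (ω : ℕ → ℝ) =>
      √n * logNorm p s (fun j : Fin n => ω j) -
        (√n)⁻¹ * ∑ j ∈ Finset.range n, normSummand p s (ω j)) atTop (fun _ => 0) := by
  rw [tendstoInMeasure_iff_norm]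
  intro ε hε
  simp only [sub_zero, Real.norm_eq_abs]
  set v := ∫ x, normSummand p s x ^ 2 ∂(genGauss p)
  have h1 (a : ℝ) (ha : 0 < a) : Tendsto (fun n : ℕ => (n : ℝ) ^ (-a)) atTop (𝓝 0) :=
    (tendsto_rpow_neg_atTop ha).comp tendsto_natCast_atTop_atTop
  have h2 : Tendsto (fun n : ℕ => ENNReal.ofReal ((n : ℝ) ^ (-(1 / 4) : ℝ) * v)) atTop (𝓝 0) := by
    simpa using ENNReal.tendsto_ofReal ((h1 (1 / 4) (by norm_num)).mul_const v)
  have h3 : ∀ᶠ n : ℕ in atTop, s * (n : ℝ) ^ (-(3 / 8) : ℝ) < 1 / 2 :=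
    ((h1 (3 / 8) (by norm_num)).const_mul s).eventually_lt_const (by norm_num)
  have h4 : ∀ᶠ n : ℕ in atTop, 2 * s * (n : ℝ) ^ (-(1 / 4) : ℝ) < ε :=
    ((h1 (1 / 4) (by norm_num)).const_mul (2 * s)).eventually_lt_const (by simpa using hε)
  refine tendsto_of_tendsto_of_tendsto_of_le_of_le' tendsto_const_nhds h2
    (Eventually.of_forall fun _ => zero_le) ?_
  filter_upwards [h3, h4, eventually_ne_atTop 0] with n h3 h4 hn
  have hn' : (0 : ℝ) < n := by positivity
  set c : ℝ := (n : ℝ) ^ (5 / 8 : ℝ) with hc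
  have hc0 : 0 < c := by positivity
  have hc1 : c / n = (n : ℝ) ^ (-(3 / 8) : ℝ) := by
    rw [hc, ← Real.rpow_sub_one hn'.ne']; norm_num
  have hc2 : c ^ 2 = (n : ℝ) ^ (5 / 4 : ℝ) := by
    rw [hc, ← Real.rpow_mul_natCast hn'.le]; norm_num
  have hc3 : n / c ^ 2 = (n : ℝ) ^ (-(1 / 4) : ℝ) := by
    nth_rw 1 [hc2, ← Real.rpow_one (n : ℝ)]
    rw [← Real.rpow_sub hn']; norm_num
  have hc4 : √n * (c / n) ^ 2 = (n : ℝ) ^ (-(1 / 4) : ℝ) := by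
    rw [hc1, Real.sqrt_eq_rpow, ← Real.rpow_mul_natCast hn'.le, ← Real.rpow_add hn']; norm_num
  have h5 := seqGenGauss_abs_sum_ge_le hp (measurable_normSummand p s) (memLp_normSummand hp hs)
    (integral_normSummand hp hs) n hc0
  rw [show n * v / c ^ 2 = n / c ^ 2 * v by ring, hc3] at h5
  refine (measure_mono fun ω hω => ?_).trans h5
  rw [mem_ofPred_eq] at hω ⊢
  by_contra! hlt
  set S := ∑ j ∈ Finset.range n, normSummand p s (ω j)
  refine hω.not_gt (lt_of_le_of_lt ?_ h4)
  have h6 : |s * S / n| ≤ s * (c / n) := by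
    rw [abs_div, abs_mul, abs_of_pos hs, abs_of_pos hn', mul_div_assoc]
    gcongr
  have h7 : |s * S / n| ≤ 1 / 2 := h6.trans (by rw [hc1]; exact h3.le)
  have h8 : √n * (Real.log (1 + s * S / n) / s) - (√n)⁻¹ * S =
      √n / s * (Real.log (1 + s * S / n) - s * S / n) := by
    have h9 := Real.mul_self_sqrt hn'.le
    have h10 : √(n : ℝ) ≠ 0 := by positivity
    field_simp
    linear_combination S * s * h9
  rw [logNorm_eq hn hp hs, h8, abs_mul, abs_of_nonneg (by positivity : 0 ≤ √(n : ℝ) / s)]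
  calc √n / s * |Real.log (1 + s * S / n) - s * S / n|
      ≤ √n / s * (2 * (s * S / n) ^ 2) := by gcongr; exact abs_log_one_add_sub_le h7
    _ ≤ √n / s * (2 * (s * (c / n)) ^ 2) := 
      mul_le_mul_of_nonneg_left (mul_le_mul_of_nonneg_left
        (sq_le_sq' (abs_le.1 h6).1 (abs_le.1 h6).2) (by norm_num)) (by positivity)
    _ = 2 * s * (√n * (c / n) ^ 2) := by field_simp
    _ = _ := by rw [hc4]

/-- The rescaled logarithmic norm ratios. -/
noncomputable def logRatio {k : ℕ} (p : ℝ) (q : Fin k → ℝ) (n : ℕ) (ω : ℕ → ℝ) : Fin k → ℝ :=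
  fun i => √n * (logNorm p (q i) (fun j : Fin n => ω j) - logNorm p p (fun j : Fin n => ω j))

@[fun_prop]
lemma measurable_logNorm {n : ℕ} (p s : ℝ) : Measurable (logNorm p s : (Fin n → ℝ) → ℝ) := by
  unfold logNorm; fun_prop

@[fun_prop]
lemma measurable_logRatio {k : ℕ} (p : ℝ) (q : Fin k → ℝ) (n : ℕ) :
    Measurable (logRatio p q n) := by
  unfold logRatio; fun_prop

lemma tendstoInDistribution_logRatio {k : ℕ} {p : ℝ} (hp : 0 < p) {q : Fin k → ℝ}
    (hq : ∀ i, 0 < q i) [IsProbabilityMeasure (seqGenGauss p)]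
    {N : Measure (Fin k → ℝ)} [IsProbabilityMeasure N]
    (hN : ∀ u : Fin k → ℝ,
      Measure.map (fun y => ∑ i, u i * y i) N =
        ProbabilityTheory.gaussianReal 0
          ((∑ i, ∑ j, u i * covEntry p (q i) (q j) * u j).toNNReal)) :
    TendstoInDistribution (logRatio p q) atTop id (fun _ => seqGenGauss p) N := by
  refine tendstoInDistribution_of_tendstoInMeasure_sub _ _ (tendstoInDistribution_ratioSum hp hq hN)
    ?_ fun n => by fun_prop
  rw [tendstoInMeasure_iff_norm]
  intro ε hε
  have h1 (s : ℝ) (hs : 0 < s) :=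
    tendstoInMeasure_iff_norm.1 (tendstoInMeasure_logNorm_sub hp hs) (ε / 2) (by positivity)
  have h2 : Tendsto (fun n : ℕ => (∑ i, seqGenGauss p {ω | ε / 2 ≤
      ‖(√n * logNorm p (q i) (fun j : Fin n => ω j) -
        (√n)⁻¹ * ∑ j ∈ Finset.range n, normSummand p (q i) (ω j)) - 0‖}) +
      seqGenGauss p {ω | ε / 2 ≤ ‖(√n * logNorm p p (fun j : Fin n => ω j) -
        (√n)⁻¹ * ∑ j ∈ Finset.range n, normSummand p p (ω j)) - 0‖}) atTop (𝓝 0) := by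
    simpa using (tendsto_finsetSum Finset.univ fun i _ => h1 _ (hq i)).add (h1 p hp)
  refine tendsto_of_tendsto_of_tendsto_of_le_of_le tendsto_const_nhds h2 (fun _ => zero_le)
    fun n => ?_
  refine (measure_mono ?_).trans ((measure_union_le (⋃ i, _) _).trans
    (add_le_add_left (measure_iUnion_fintype_le _ _) _))
  intro ω hω
  by_contra! hc
  simp only [mem_union, mem_iUnion, mem_ofPred_eq, not_or, not_exists, not_le, sub_zero,
    Real.norm_eq_abs] at hc hω
  refine hω.not_gt ((pi_norm_lt_iff hε).2 fun i => ?_)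
  have h3 := hc.1 i
  have h4 := hc.2
  rw [abs_lt] at h3 h4
  simp only [Pi.sub_apply, Pi.zero_apply, sub_zero, logRatio, ratioSum, ratioSummand,
    Finset.sum_sub_distrib, Real.norm_eq_abs, mul_sub]
  rw [abs_lt]
  constructor <;> linarith

lemma tendsto_seqGenGauss_logRatio_le {k : ℕ} {p : ℝ} (hp : 0 < p) {q : Fin k → ℝ}
    (hq : ∀ i, 0 < q i) {N : Measure (Fin k → ℝ)} [IsProbabilityMeasure N]
    (hN : ∀ u : Fin k → ℝ,
      Measure.map (fun y => ∑ i, u i * y i) N =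
        ProbabilityTheory.gaussianReal 0
          ((∑ i, ∑ j, u i * covEntry p (q i) (q j) * u j).toNNReal))
    {d c : ℕ → Fin k → ℝ} {d' c' : Fin k → ℝ} (hd : Tendsto d atTop (𝓝 d'))
    (hc : Tendsto c atTop (𝓝 c')) (h0 : ∀ i, N {y | d' i * y i = c' i} = 0) :
    Tendsto (fun n => seqGenGauss p {ω | ∀ i, d n i * logRatio p q n ω i ≤ c n i}) atTop
      (𝓝 (N {y | ∀ i, d' i * y i ≤ c' i})) := by
  have := isProbabilityMeasure_seqGenGauss hp
  have h1 : Tendsto (fun n => (d n, c n)) atTop (𝓝 (d', c')) := hd.prodMk_nhds hc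
  have h2 : TendstoInMeasure (seqGenGauss p) (fun n _ => (d n, c n)) atTop
      (fun _ => (d', c')) :=
    tendstoInMeasure_of_tendsto_ae (fun n => aestronglyMeasurable_const) (ae_of_all _ fun _ => h1)
  have h3 := TendstoInDistribution.continuous_comp_prodMk_of_tendstoInMeasure_const
    (g := fun z : (Fin k → ℝ) × (Fin k → ℝ) × (Fin k → ℝ) => z.2.1 * z.1 - z.2.2)
    (by fun_prop) (tendstoInDistribution_logRatio hp hq hN) h2 (fun n => by fun_prop)
  have hm : MeasurableSet (Iic (0 : Fin k → ℝ)) := measurableSet_Iic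
  have hmap : Measurable fun y : Fin k → ℝ => d' * y - c' := by fun_prop
  have h4 := ProbabilityMeasure.tendsto_measure_of_null_frontier_of_tendsto' h3.tendsto
    (E := Iic 0) ?_
  · refine (h4.congr fun n => ?_).trans_eq ?_
    · simp only [ProbabilityMeasure.coe_mk]
      rw [Measure.map_apply (by fun_prop) hm]
      congr 1
      ext ω
      simp [Pi.le_def]
    · simp only [ProbabilityMeasure.coe_mk, id]
      rw [Measure.map_apply hmap hm]
      congr 2
      ext y
      simp [Pi.le_def]
  · simp only [ProbabilityMeasure.coe_mk, id]
    rw [Measure.map_apply hmap isClosed_frontier.measurableSet]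
    refine measure_mono_null ?_ (measure_iUnion_null h0)
    intro y hy
    by_contra hne
    simp only [mem_iUnion, mem_ofPred_eq, not_exists] at hne
    rw [mem_preimage, isClosed_Iic.frontier_eq] at hy
    refine hy.2 ?_
    rw [show Iic (0 : Fin k → ℝ) = univ.pi fun _ => Iic 0 by ext; simp [Pi.le_def],
      interior_pi_set finite_univ]
    intro i _
    have h5 : d' i * y i ≤ c' i := by simpa using hy.1 i
    simpa using lt_of_le_of_ne h5 (hne i)

lemma measure_apply_eq_zero_of_gaussian {k : ℕ} {C : Fin k → Fin k → ℝ}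
    {N : Measure (Fin k → ℝ)}
    (hN : ∀ u : Fin k → ℝ,
      Measure.map (fun y => ∑ i, u i * y i) N =
        ProbabilityTheory.gaussianReal 0 ((∑ i, ∑ j, u i * C i j * u j).toNNReal))
    {i : Fin k} (hC : 0 < C i i) : N {y | y i = 0} = 0 := by
  have h1 := hN (Pi.single i 1)
  simp only [Pi.single_apply, ite_mul, mul_ite, one_mul, mul_one, zero_mul, mul_zero,
    Finset.sum_ite_eq', Finset.mem_univ, if_true] at h1
  have : NullSingletonClass (Measure.map (fun y : Fin k → ℝ => y i) N) := by
    rw [h1]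
    exact ProbabilityTheory.nullSingletonClass_gaussianReal (by simpa using hC)
  have h2 := measure_singleton (μ := Measure.map (fun y : Fin k → ℝ => y i) N) (0 : ℝ)
  rw [Measure.map_apply (by fun_prop) (measurableSet_singleton _)] at h2
  exact h2

lemma tendsto_pi_genGauss_normCone {k : ℕ} {p : ℝ} (hp : 1 ≤ p) {q : Fin k → ℝ}
    (hq : ∀ i, 1 ≤ q i) (hqp : ∀ i, q i ≠ p) {t : Fin k → ℝ} (ht : ∀ i, 0 < t i) {A : Fin k → ℝ}
    (hA : ∀ i, Tendsto (fun n : ℕ => Apqn p (q i) n) atTop (𝓝 (A i))) (hApos : ∀ i, 0 < A i)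
    {N : Measure (Fin k → ℝ)} [IsProbabilityMeasure N]
    (hN : ∀ u : Fin k → ℝ,
      Measure.map (fun y => ∑ i, u i * y i) N =
        ProbabilityTheory.gaussianReal 0
          ((∑ i, ∑ j, u i * covEntry p (q i) (q j) * u j).toNNReal))
    {δ : ℕ → ℝ} (hδ : ∀ n, 0 < δ n)
    (hδ' : Tendsto (fun n : ℕ => √n * Real.log (δ n)) atTop (𝓝 0)) :
    Tendsto (fun n : ℕ => Measure.pi (fun _ : Fin n => genGauss p)
        (normCone n p q fun i => relRadius n p (q i) (t i) / δ n)) atTop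
      (𝓝 (N {y | ∀ i, (if A i * t i = 1 then 1 else 0) * y i ≤ Real.log (A i * t i)})) := by
  have hp0 : 0 < p := by linarith
  have hq0 (i) : 0 < q i := zero_lt_one.trans_le (hq i)
  have := isProbabilityMeasure_seqGenGauss hp0
  set d : ℕ → Fin k → ℝ := fun n i => if A i * t i = 1 then 1 else (√n)⁻¹ with hd
  set c : ℕ → Fin k → ℝ := fun n i =>
    d n i * (√n * (Real.log (Apqn p (q i) n) + Real.log (t i) - Real.log (δ n))) with hc
  have hlog (i) : Real.log (A i * t i) = Real.log (A i) + Real.log (t i) :=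
    Real.log_mul (hApos i).ne' (ht i).ne'
  have hinv : Tendsto (fun n : ℕ => (√(n : ℝ))⁻¹) atTop (𝓝 0) :=
    tendsto_inv_atTop_zero.comp (Real.tendsto_sqrt_atTop.comp tendsto_natCast_atTop_atTop)
  have hd' : Tendsto d atTop (𝓝 fun i => if A i * t i = 1 then 1 else 0) := by
    refine tendsto_pi_nhds.2 fun i => ?_
    by_cases h : A i * t i = 1 <;> simp [hd, h, hinv]
  have hc' : Tendsto c atTop (𝓝 fun i => Real.log (A i * t i)) := by
    refine tendsto_pi_nhds.2 fun i => ?_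
    have h1 := (tendsto_sqrt_mul_log_Apqn_sub hp (hq i) (hApos i) (hA i)).sub hδ'
    rw [sub_zero] at h1
    by_cases h : A i * t i = 1
    · have h2 := hlog i
      rw [h, Real.log_one] at h2
      simp only [hc, hd, h, if_true, one_mul, Real.log_one]
      refine h1.congr fun n => ?_
      linear_combination √(n : ℝ) * h2
    · have h2 := (hinv.mul h1).add_const (Real.log (A i * t i))
      rw [mul_zero, zero_add] at h2
      refine h2.congr' ?_
      filter_upwards [eventually_ne_atTop 0] with n hn
      have h3 : √(n : ℝ) ≠ 0 := by positivity
      simp only [hc, hd, h, if_false]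
      rw [inv_mul_cancel_left₀ h3, ← mul_sub, inv_mul_cancel_left₀ h3, hlog]
      ring
  have key := tendsto_seqGenGauss_logRatio_le hp0 hq0 hN hd' hc' fun i => by
    by_cases h : A i * t i = 1
    · simpa [h] using measure_apply_eq_zero_of_gaussian hN (covEntry_self_pos hp0 (hq0 i) (hqp i))
    · have h1 : Real.log (A i * t i) ≠ 0 :=
        Real.log_ne_zero_of_pos_of_ne_one (mul_pos (hApos i) (ht i)) h
      simp [h, h1.symm]
  refine key.congr' ?_
  filter_upwards [eventually_ne_atTop 0] with n hn
  rw [← map_seqGenGauss_fin hp0,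
    Measure.map_apply (by fun_prop) (measurableSet_normCone _ _ _ _)]
  have h0 : ∀ᵐ ω ∂(seqGenGauss p), (fun j : Fin n => ω j) ≠ 0 := by
    have h1 : ∀ᵐ x ∂(genGauss p), x ≠ 0 :=
      (withDensity_absolutelyContinuous _ _).ae_le (Measure.ae_ne volume (0 : ℝ))
    filter_upwards [(measurePreserving_eval_seqGenGauss hp0 0).quasiMeasurePreserving.ae h1]
      with ω hω h2
    exact hω (congrFun h2 ⟨0, Nat.pos_of_ne_zero hn⟩)
  refine measure_congr ?_
  filter_upwards [h0] with ω hω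
  refine propext ?_
  refine Iff.trans ?_ (mem_normCone_iff hn hp hq ht (hδ n) hω).symm
  refine forall_congr' fun i => ?_
  have h3 : 0 < d n i := by
    simp only [hd]; split_ifs <;> positivity
  have h4 : 0 < √(n : ℝ) := by positivity
  rw [hc]
  simp only [logRatio]
  rw [mul_le_mul_iff_right₀ h3, mul_le_mul_iff_right₀ h4]

lemma tendsto_volume_inter_nBall {k : ℕ} {p : ℝ} (hp : 1 ≤ p) {q : Fin k → ℝ}
    (hq : ∀ i, 1 ≤ q i) (hqp : ∀ i, q i ≠ p) {t : Fin k → ℝ} (ht : ∀ i, 0 < t i) {A : Fin k → ℝ}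
    (hA : ∀ i, Tendsto (fun n : ℕ => Apqn p (q i) n) atTop (𝓝 (A i))) (hApos : ∀ i, 0 < A i)
    {N : Measure (Fin k → ℝ)} [IsProbabilityMeasure N]
    (hN : ∀ u : Fin k → ℝ,
      Measure.map (fun y => ∑ i, u i * y i) N =
        ProbabilityTheory.gaussianReal 0
          ((∑ i, ∑ j, u i * covEntry p (q i) (q j) * u j).toNNReal)) :
    Tendsto (fun n : ℕ => (volume (nBall n p ∩ ⋂ i, t i • nBall n (q i))).toReal) atTop
      (𝓝 (N {y | ∀ i, (if A i * t i = 1 then 1 else 0) * y i ≤ Real.log (A i * t i)}).toReal) := by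
  have hpow (a : ℝ) (ha : 0 < a) : Tendsto (fun n : ℕ => (n : ℝ) ^ (-a)) atTop (𝓝 0) :=
    (tendsto_rpow_neg_atTop ha).comp tendsto_natCast_atTop_atTop
  have hlower := tendsto_pi_genGauss_normCone hp hq hqp ht hA hApos hN (δ := fun _ => 1)
    (fun _ => one_pos) (by simp)
  set δ : ℕ → ℝ := fun n => Real.exp (-(n : ℝ) ^ (-(3 / 4) : ℝ)) with hδ
  have hupper := tendsto_pi_genGauss_normCone hp hq hqp ht hA hApos hN (δ := δ)
    (fun _ => Real.exp_pos _) (by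
      have h1 := (hpow (1 / 4) (by norm_num)).neg
      rw [neg_zero] at h1
      refine h1.congr' ?_
      filter_upwards [eventually_ne_atTop 0] with n hn
      have hn' : (0 : ℝ) < n := by positivity
      rw [hδ, Real.log_exp, Real.sqrt_eq_rpow, mul_neg, ← Real.rpow_add hn']
      norm_num)
  have hδn : Tendsto (fun n : ℕ => ENNReal.ofReal (δ n ^ n)) atTop (𝓝 0) := by
    have h1 : Tendsto (fun n : ℕ => Real.exp (-(n : ℝ) ^ (1 / 4 : ℝ))) atTop (𝓝 0) :=
      Real.tendsto_exp_neg_atTop_nhds_zero.comp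
        ((tendsto_rpow_atTop (by norm_num)).comp tendsto_natCast_atTop_atTop)
    rw [← ENNReal.ofReal_zero]
    refine ENNReal.tendsto_ofReal (h1.congr' ?_)
    filter_upwards [eventually_ne_atTop 0] with n hn
    have hn' : (n : ℝ) ≠ 0 := by exact_mod_cast hn
    rw [hδ, ← Real.exp_nat_mul, mul_neg, mul_comm, ← Real.rpow_add_one hn']
    norm_num
  have hupper' := hupper.add hδn
  rw [add_zero] at hupper'
  refine (ENNReal.tendsto_toReal (measure_ne_top _ _)).comp
    (tendsto_of_tendsto_of_tendsto_of_le_of_le' hlower hupper' ?_ ?_)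
  · filter_upwards [eventually_ne_atTop 0] with n hn
    simpa using pi_genGauss_normCone_le_volume hn hp hq ht
  · filter_upwards [eventually_ne_atTop 0] with n hn
    exact volume_le_pi_genGauss_normCone hn hp hq ht (Real.exp_pos _)

/-- Asymptotic volume of the simultaneous intersection of several dilated normalized
`ℓ_p^n`-balls: with `I_> = {i : A_{p,q_i} t_i > 1}`, `I_= = {i : A_{p,q_i} t_i = 1}`,
`I_< = {i : A_{p,q_i} t_i < 1}`, the limit of
`|𝔻_p^n ∩ t_1 𝔻_{q_1}^n ∩ ⋯ ∩ t_k 𝔻_{q_k}^n|` is `1` if `#I_> = k`, equals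
`ℙ(N_i ≤ 0 ∀ i ∈ I_=)` if `#I_= ≥ 1` and `#I_< = 0`, and is `0` if `#I_< ≥ 1`; here
`N = (N_1,…,N_k)` is the centred Gaussian vector with covariance matrix `(c_{i,j})`. -/
theorem volume_multi_intersection_lp_balls (k : ℕ) (p : ℝ) (hp : 1 ≤ p)
    (q : Fin k → ℝ) (hq : ∀ i, 1 ≤ q i) (hqp : ∀ i, q i ≠ p)
    (t : Fin k → ℝ) (ht : ∀ i, 0 < t i)
    -- `A i = A_{p,q_i}` is the limit of `A_{p,q_i,n}`, which exists in `(0,∞)`: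
    (A : Fin k → ℝ) (hA : ∀ i, Tendsto (fun n : ℕ => Apqn p (q i) n) atTop (𝓝 (A i)))
    (hApos : ∀ i, 0 < A i)
    -- `N` is the centred Gaussian measure on `ℝ^k` with covariance matrix `(c_{i,j})`:
    (N : Measure (Fin k → ℝ)) (hNprob : IsProbabilityMeasure N)
    (hNgauss : ∀ u : Fin k → ℝ,
      Measure.map (fun y => ∑ i, u i * y i) N =
        ProbabilityTheory.gaussianReal 0
          ((∑ i, ∑ j, u i * covEntry p (q i) (q j) * u j).toNNReal)) :
    ((∀ i, 1 < A i * t i) →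
      Tendsto (fun n : ℕ =>
          (volume (nBall n p ∩ ⋂ i, t i • nBall n (q i))).toReal) atTop (𝓝 1)) ∧
    ((∃ i, A i * t i = 1) → (∀ i, 1 ≤ A i * t i) →
      Tendsto (fun n : ℕ =>
          (volume (nBall n p ∩ ⋂ i, t i • nBall n (q i))).toReal) atTop
        (𝓝 ((N {y | ∀ i, A i * t i = 1 → y i ≤ 0}).toReal))) ∧
    ((∃ i, A i * t i < 1) →
      Tendsto (fun n : ℕ =>
          (volume (nBall n p ∩ ⋂ i, t i • nBall n (q i))).toReal) atTop (𝓝 0)) := by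
  have key := tendsto_volume_inter_nBall hp hq hqp ht hA hApos hNgauss
  refine ⟨fun h => ?_, fun _ h => ?_, fun ⟨i, hi⟩ => ?_⟩
  · have huniv : {y : Fin k → ℝ | ∀ i, (if A i * t i = 1 then 1 else 0) * y i ≤
        Real.log (A i * t i)} = univ :=
      eq_univ_of_forall fun y i => by
        rw [if_neg (h i).ne', zero_mul]
        exact Real.log_nonneg (h i).le
    rwa [huniv, measure_univ, ENNReal.toReal_one] at key
  · have hset : {y : Fin k → ℝ | ∀ i, (if A i * t i = 1 then 1 else 0) * y i ≤
        Real.log (A i * t i)} = {y | ∀ i, A i * t i = 1 → y i ≤ 0} := by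
      ext y
      refine forall_congr' fun i => ?_
      by_cases hi : A i * t i = 1
      · simp [hi]
      · simp [hi, Real.log_nonneg (h i)]
    rwa [hset] at key
  · have hempty : {y : Fin k → ℝ | ∀ i, (if A i * t i = 1 then 1 else 0) * y i ≤
        Real.log (A i * t i)} = ∅ :=
      eq_empty_of_forall_notMem fun y hy => by
        have h1 := hy i
        rw [if_neg hi.ne, zero_mul] at h1
        exact h1.not_gt (Real.log_neg (mul_pos (hApos i) (ht i)) hi)
    rwa [hempty, measure_empty, ENNReal.toReal_zero] at key
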